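/- Let 0 < σ ≤ 1 and φ ∈ C¹([a,b]) strictly increasing. For 0 < Re α ≤ Re β with Re α, Re β and Re(α+β) appropriate (0 < Re α, 0 < Re β), the proportional fractional integrals with respect to φ satisfy the semigroup property: (ₐI^{α,σ,φ} (ₐI^{β,σ,φ} f))(t) = (ₐI^{α+β,σ,φ} f)(t) for continuous f : [a,b] → ℝ and t ∈ [a,b]. -/

import Mathlib

open Complex intervalIntegral

/-- The left proportional fractional integral with respect to `φ`:
`(ₐI^{α,σ,φ} f)(t) = (1/(σ^α Γ(α))) ∫ₐᵗ e^{((σ−1)/σ)(φ(t)−φ(τ))} (φ(t)−φ(τ))^{α−1} f(τ) φ'(τ) dτ`. -/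
noncomputable def propIntPhi (α : ℂ) (σ : ℝ) (φ : ℝ → ℝ) (f : ℝ → ℂ) (a t : ℝ) : ℂ :=
  (1 / ((σ : ℂ) ^ α * Complex.Gamma α)) *
    ∫ τ in a..t, Complex.exp (((((σ - 1) / σ) * (φ t - φ τ) : ℝ)) : ℂ) *
      ((φ t - φ τ : ℝ) : ℂ) ^ (α - 1) * f τ * ((deriv φ τ : ℝ) : ℂ)

open MeasureTheory Set in
theorem aux_cov (a b : ℝ) (φ : ℝ → ℝ) (hφ : ContDiff ℝ 1 φ) (hm : StrictMonoOn φ (Set.Icc a b))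
    (g : ℝ → ℂ) (t : ℝ) (ht : t ∈ Set.Icc a b) :
    ∫ τ in a..t, g (φ τ) * ((deriv φ τ : ℝ) : ℂ) = ∫ u in (φ a)..(φ t), g u := by
  rcases eq_or_lt_of_le ht.1 with h | h
  · subst h; simp
  have hsub : Icc a t ⊆ Icc a b := Icc_subset_Icc_right ht.2
  have hm' := hm.mono hsub
  have hle : φ a ≤ φ t := (hm' ⟨le_rfl, h.le⟩ ⟨h.le, le_rfl⟩ h).le
  have himg : φ '' Icc a t = Icc (φ a) (φ t) := by
    apply Subset.antisymm
    · rintro _ ⟨x, hx, rfl⟩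
      exact ⟨hm'.monotoneOn ⟨le_rfl, h.le⟩ hx hx.1, hm'.monotoneOn hx ⟨h.le, le_rfl⟩ hx.2⟩
    · exact intermediate_value_Icc h.le hφ.continuous.continuousOn
  have hd : ∀ x, HasDerivAt φ (deriv φ x) x := fun x =>
    ((hφ.differentiable one_ne_zero) x).hasDerivAt
  have := integral_image_eq_integral_abs_deriv_smul (measurableSet_Icc (a := a) (b := t))
    (fun x _ => (hd x).hasDerivWithinAt) hm'.injOn g
  rw [himg] at this
  rw [integral_of_le h.le, integral_of_le hle, ← integral_Icc_eq_integral_Ioc,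
    ← integral_Icc_eq_integral_Ioc, this]
  apply setIntegral_congr_fun measurableSet_Icc
  intro x hx
  have h0 : 0 ≤ deriv φ x := by
    rw [← (hd x).differentiableAt.derivWithin (uniqueDiffOn_Icc h x hx)]
    exact hm'.monotoneOn.derivWithin_nonneg
  simp only [abs_of_nonneg h0, Complex.real_smul]
  ring

/-- the kernel -/
noncomputable def auxK (c : ℝ) (γ : ℂ) (y : ℝ) : ℂ :=
  Complex.exp ((c * y : ℝ) : ℂ) * ((y : ℝ) : ℂ) ^ (γ - 1)

theorem auxK_beta (c : ℝ) (α β : ℂ) (v x : ℝ) (h : v < x) :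
    ∫ u in v..x, auxK c α (x - u) * auxK c β (u - v)
      = Complex.betaIntegral α β * auxK c (α + β) (x - v) := by
  have h1 := intervalIntegral.integral_comp_sub_left (a := v) (b := x)
    (fun y => auxK c α y * auxK c β ((x - v) - y)) x
  have h2 : ∀ u : ℝ, x - v - (x - u) = u - v := fun u => by ring
  simp only [h2, sub_self] at h1
  rw [h1]
  have h3 : ∀ y : ℝ, auxK c α y * auxK c β (x - v - y) =
      Complex.exp ((c * (x - v) : ℝ) : ℂ) *
        ((y : ℂ) ^ (α - 1) * (((x - v : ℝ) : ℂ) - y) ^ (β - 1)) := by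
    intro y
    have : Complex.exp ((c * (x - v) : ℝ) : ℂ) =
        Complex.exp ((c * y : ℝ) : ℂ) * Complex.exp ((c * (x - v - y) : ℝ) : ℂ) := by
      rw [← Complex.exp_add]; congr 1; push_cast; ring
    rw [this]
    simp only [auxK]
    push_cast
    ring
  simp only [h3]
  rw [intervalIntegral.integral_const_mul, Complex.betaIntegral_scaled α β (sub_pos.2 h)]
  simp only [auxK]
  ring

open MeasureTheory Set in
theorem auxK_int (c : ℝ) (γ : ℂ) (hγ : 0 < γ.re) (L : ℝ) :
    Integrable (indicator (Ioo 0 L) (auxK c γ)) := by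
  rw [integrable_indicator_iff measurableSet_Ioo]
  rcases le_total L 0 with h | h
  · simp [Ioo_eq_empty (not_lt.2 h)]
  have h1 : IntervalIntegrable (fun x : ℝ => (x : ℂ) ^ (γ - 1)) volume 0 L :=
    intervalIntegral.intervalIntegrable_cpow' (by simp; exact hγ)
  have h2 := h1.continuousOn_mul (g := fun y : ℝ => Complex.exp ((c * y : ℝ) : ℂ))
    (by fun_prop)
  rw [intervalIntegrable_iff_integrableOn_Ioo_of_le h] at h2
  exact h2

open MeasureTheory Set in
theorem aux_semi (c : ℝ) (α β : ℂ) (hα : 0 < α.re) (hβ : 0 < β.re) (A x : ℝ) (hAx : A ≤ x)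
    (F : ℝ → ℂ) (M : ℝ) (hM : ∀ u ∈ Ioo A x, ‖F u‖ ≤ M)
    (hF : AEStronglyMeasurable F (volume.restrict (Ioo A x))) :
    ∫ u in A..x, auxK c α (x - u) * ∫ v in A..u, auxK c β (u - v) * F v
      = Complex.betaIntegral α β * ∫ v in A..x, auxK c (α + β) (x - v) * F v := by
  set L := x - A with hL
  set G := indicator (Ioo A x) F with hG
  set Ka := indicator (Ioo 0 L) (auxK c α) with hKa
  set Kb := indicator (Ioo 0 L) (auxK c β) with hKb
  have hGm : AEStronglyMeasurable G volume :=
    (aestronglyMeasurable_indicator_iff measurableSet_Ioo).2 hF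
  have hGb : ∀ v, ‖G v‖ ≤ max M 0 := by
    intro v
    by_cases hv : v ∈ Ioo A x
    · simp only [hG, indicator_of_mem hv]; exact le_max_of_le_left (hM v hv)
    · simp [hG, indicator_of_notMem hv]
  have hI : Integrable (Function.uncurry
      (fun (v u : ℝ) => G v * (Ka (x - u) * Kb (u - v)))) (volume.prod volume) := by
    have h1 := (auxK_int c α hα L).comp_sub_left x
    have h2 := (auxK_int c β hβ L).comp_neg
    have h3 := Integrable.convolution_integrand (ContinuousLinearMap.mul ℝ ℂ) h1 h2
    have h4 : Integrable (fun p : ℝ × ℝ => Ka (x - p.2) * Kb (p.2 - p.1))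
        (volume.prod volume) := by
      refine h3.congr (Filter.Eventually.of_forall fun p => ?_)
      simp [hKa, hKb]
    exact h4.bdd_mul (f := fun p : ℝ × ℝ => G p.1) (c := max M 0) hGm.comp_fst
      (Filter.Eventually.of_forall fun p => hGb p.1)
  have hsw := integral_integral_swap hI
  have e1 : ∫ u in A..x, auxK c α (x - u) * ∫ v in A..u, auxK c β (u - v) * F v
      = ∫ u, ∫ v, G v * (Ka (x - u) * Kb (u - v)) := by
    rw [integral_of_le hAx, integral_Ioc_eq_integral_Ioo, ← MeasureTheory.integral_indicator measurableSet_Ioo]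
    congr 1
    ext u
    by_cases hu : u ∈ Ioo A x
    · have hxu : x - u ∈ Ioo 0 L := ⟨by linarith [hu.2], by linarith [hu.1]⟩
      rw [indicator_of_mem hu, integral_of_le hu.1.le, integral_Ioc_eq_integral_Ioo,
        ← MeasureTheory.integral_indicator measurableSet_Ioo, ← MeasureTheory.integral_const_mul]
      congr 1
      ext v
      simp only [hKa, indicator_of_mem hxu]
      by_cases hv : v ∈ Ioo A u
      · have h1 : v ∈ Ioo A x := ⟨hv.1, hv.2.trans hu.2⟩
        have h2 : u - v ∈ Ioo 0 L := ⟨by linarith [hv.2], by linarith [hv.1, hu.2]⟩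
        simp only [hG, hKb, indicator_of_mem hv, indicator_of_mem h1, indicator_of_mem h2]
        ring
      · rw [indicator_of_notMem hv]
        by_cases h1 : v ∈ Ioo A x
        · have h2 : u - v ∉ Ioo 0 L := fun h => hv ⟨h1.1, by linarith [h.1]⟩
          simp only [hKb, indicator_of_notMem h2]; ring
        · simp only [hG, indicator_of_notMem h1]; ring
    · have hxu : x - u ∉ Ioo 0 L := fun h => hu ⟨by linarith [h.2], by linarith [h.1]⟩
      simp [hKa, indicator_of_notMem hu, indicator_of_notMem hxu]
  have e2 : Complex.betaIntegral α β * ∫ v in A..x, auxK c (α + β) (x - v) * F v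
      = ∫ v, ∫ u, G v * (Ka (x - u) * Kb (u - v)) := by
    rw [integral_of_le hAx, integral_Ioc_eq_integral_Ioo, ← MeasureTheory.integral_indicator measurableSet_Ioo,
      ← MeasureTheory.integral_const_mul]
    congr 1
    ext v
    rw [MeasureTheory.integral_const_mul]
    by_cases hv : v ∈ Ioo A x
    · simp only [hG, indicator_of_mem hv]
      rw [← mul_assoc, ← auxK_beta c α β v x hv.2, mul_comm]
      congr 1
      rw [integral_of_le hv.2.le, integral_Ioc_eq_integral_Ioo,
        ← MeasureTheory.integral_indicator measurableSet_Ioo]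
      congr 1
      ext u
      by_cases hu : u ∈ Ioo v x
      · have h1 : x - u ∈ Ioo 0 L := ⟨by linarith [hu.2], by linarith [hu.1, hv.1]⟩
        have h2 : u - v ∈ Ioo 0 L := ⟨by linarith [hu.1], by linarith [hu.2, hv.1]⟩
        simp only [hKa, hKb, indicator_of_mem hu, indicator_of_mem h1, indicator_of_mem h2]
      · rw [indicator_of_notMem hu]
        by_cases h1 : x - u ∈ Ioo 0 L
        · have h2 : u - v ∉ Ioo 0 L := fun h => hu ⟨by linarith [h.1], by linarith [h1.1]⟩
          simp only [hKb, indicator_of_notMem h2]; ring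
        · simp only [hKa, indicator_of_notMem h1]; ring
    · simp [hG, indicator_of_notMem hv]
  rw [e1, e2, hsw]

open MeasureTheory Set in
theorem aux_prop (γ : ℂ) (σ a b : ℝ) (φ : ℝ → ℝ)
    (hφ : ContDiff ℝ 1 φ) (hm : StrictMonoOn φ (Set.Icc a b)) (f F : ℝ → ℂ)
    (t : ℝ) (ht : t ∈ Icc a b) (hF : ∀ τ ∈ Icc a b, F (φ τ) = f τ) :
    propIntPhi γ σ φ f a t = (1 / ((σ : ℂ) ^ γ * Complex.Gamma γ)) *
      ∫ u in (φ a)..(φ t), auxK ((σ - 1) / σ) γ (φ t - u) * F u := by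
  rw [← aux_cov a b φ hφ hm _ t ht, propIntPhi]
  congr 1
  apply intervalIntegral.integral_congr
  intro τ hτ
  rw [uIcc_of_le ht.1] at hτ
  simp only [auxK, hF τ ⟨hτ.1, hτ.2.trans ht.2⟩]

open MeasureTheory Set in
/-- semigroup property of the proportional fractional integrals with
respect to `φ`: `ₐI^{α,σ,φ}(ₐI^{β,σ,φ} f) = ₐI^{α+β,σ,φ} f` for continuous `f`. -/
theorem propIntPhi_semigroup (σ : ℝ) (hσ0 : 0 < σ) (hσ1 : σ ≤ 1)
    (a b : ℝ) (hab : a < b) (φ : ℝ → ℝ)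
    (hφ : ContDiff ℝ 1 φ) (hφmono : StrictMonoOn φ (Set.Icc a b))
    (α β : ℂ) (hα : 0 < α.re) (hβ : 0 < β.re)
    (f : ℝ → ℝ) (hf : ContinuousOn f (Set.Icc a b)) :
    ∀ t ∈ Set.Icc a b,
      propIntPhi α σ φ (fun s => propIntPhi β σ φ (fun τ => (f τ : ℂ)) a s) a t
        = propIntPhi (α + β) σ φ (fun τ => (f τ : ℂ)) a t := by
  intro t ht
  set ψ := Function.invFunOn φ (Icc a b) with hψ
  have hinv : ∀ τ ∈ Icc a b, ψ (φ τ) = τ := fun τ hτ =>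
    hφmono.injOn.leftInvOn_invFunOn hτ
  have himg : ∀ u ∈ Ioo (φ a) (φ t), ∃ τ ∈ Icc a b, φ τ = u := by
    intro u hu
    obtain ⟨τ, hτ, h⟩ := intermediate_value_Icc ht.1 hφ.continuous.continuousOn
      (Ioo_subset_Icc_self hu)
    exact ⟨τ, ⟨hτ.1, hτ.2.trans ht.2⟩, h⟩
  set f' : ℝ → ℝ := IccExtend hab.le ((Icc a b).domRestrict f) with hf'
  have hf'c : Continuous f' := (continuousOn_iff_continuous_domRestrict.1 hf).Icc_extend'
  have hf'e : ∀ τ ∈ Icc a b, f' τ = f τ := fun τ hτ => by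
    rw [hf', IccExtend_of_mem _ _ hτ]; rfl
  set F : ℝ → ℂ := fun u => (f' (ψ u) : ℂ) with hFdef
  have hFe : ∀ τ ∈ Icc a b, F (φ τ) = (f τ : ℂ) := fun τ hτ => by
    simp only [hFdef, hinv τ hτ, hf'e τ hτ]
  obtain ⟨M, hM⟩ := isCompact_Icc.exists_bound_of_continuousOn hf
  have hFM : ∀ u ∈ Ioo (φ a) (φ t), ‖F u‖ ≤ M := by
    intro u hu
    obtain ⟨τ, hτ, rfl⟩ := himg u hu
    rw [hFe τ hτ, Complex.norm_real]
    exact hM τ hτ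
  have hψm : MonotoneOn ψ (Ioo (φ a) (φ t)) := by
    intro u hu v hv huv
    obtain ⟨τ, hτ, rfl⟩ := himg u hu
    obtain ⟨τ', hτ', rfl⟩ := himg v hv
    rw [hinv τ hτ, hinv τ' hτ']
    exact (hφmono.le_iff_le hτ hτ').1 huv
  have hFm : AEStronglyMeasurable F (volume.restrict (Ioo (φ a) (φ t))) := by
    have h1 : AEMeasurable ψ (volume.restrict (Ioo (φ a) (φ t))) :=
      aemeasurable_restrict_of_monotoneOn measurableSet_Ioo hψm
    have h2 : Measurable (fun y => (f' y : ℂ)) :=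
      (Complex.continuous_ofReal.comp hf'c).measurable
    exact (h2.comp_aemeasurable h1).aestronglyMeasurable
  have hle : φ a ≤ φ t := hφmono.monotoneOn ⟨le_rfl, hab.le⟩ ht ht.1
  set c := (σ - 1) / σ with hc
  rw [aux_prop α σ a b φ hφ hφmono _
    (fun u => (1 / ((σ : ℂ) ^ β * Complex.Gamma β)) *
      ∫ v in (φ a)..u, auxK c β (u - v) * F v) t ht
    (fun τ hτ => (aux_prop β σ a b φ hφ hφmono _ F τ hτ hFe).symm),
    aux_prop (α + β) σ a b φ hφ hφmono _ F t ht hFe]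
  simp only [mul_left_comm _ (1 / ((σ : ℂ) ^ β * Complex.Gamma β)) _]
  rw [intervalIntegral.integral_const_mul, aux_semi c α β hα hβ _ _ hle F M hFM hFm]
  have hσ : (σ : ℂ) ≠ 0 := by exact_mod_cast hσ0.ne'
  have hB := Complex.Gamma_mul_Gamma_eq_betaIntegral hα hβ
  have hGa := Complex.Gamma_ne_zero_of_re_pos hα
  have hGb := Complex.Gamma_ne_zero_of_re_pos hβ
  have hGab : Complex.Gamma (α + β) ≠ 0 :=
    Complex.Gamma_ne_zero_of_re_pos (by simp; linarith)
  have hB' : Complex.betaIntegral α β =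
      Complex.Gamma α * Complex.Gamma β / Complex.Gamma (α + β) := by
    rw [hB]; field_simp
  have hsa : (σ : ℂ) ^ α ≠ 0 := by simp [Complex.cpow_eq_zero_iff, hσ]
  have hsb : (σ : ℂ) ^ β ≠ 0 := by simp [Complex.cpow_eq_zero_iff, hσ]
  rw [hB', Complex.cpow_add _ _ hσ]
  generalize (∫ v in (φ a)..(φ t), auxK c (α + β) (φ t - v) * F v) = I
  field_simp
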